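/- Under hypothesis (H3), any weak* accumulation point ν of the sequence (ν_n) is an ergodic g-invariant probability measure. -/

import Mathlib

open MeasureTheory Filter Topology Set
open scoped ENNReal NNReal

namespace Samva

variable {X : Type*}

/-- The `n`-th iterate (`n : ℤ`) of a homeomorphism. -/
noncomputable def zIter [TopologicalSpace X] (f : X ≃ₜ X) : ℤ → X → X
  | Int.ofNat n => (f : X → X)^[n]
  | Int.negSucc n => (f.symm : X → X)^[n + 1]

/-- `f` is expansive with expansivity constant `α`. -/
def IsExpansiveWith [PseudoMetricSpace X] (f : X ≃ₜ X) (α : ℝ) : Prop :=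
  0 < α ∧ ∀ x y : X, (∀ n : ℤ, dist (zIter f n x) (zIter f n y) ≤ α) → x = y

/-- `f` is expansive. -/
def IsExpansive [PseudoMetricSpace X] (f : X ≃ₜ X) : Prop :=
  ∃ α : ℝ, IsExpansiveWith f α

/-- The (periodic) specification property. -/
def HasSpecification [PseudoMetricSpace X] (f : X ≃ₜ X) : Prop :=
  ∀ ε : ℝ, 0 < ε → ∃ M : ℕ, ∀ (k : ℕ) (x : Fin (k + 1) → X) (a b : Fin (k + 1) → ℤ),
    (∀ i, a i ≤ b i) →
    (∀ i : Fin k, (M : ℤ) ≤ a i.succ - b i.castSucc) →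
    ∀ p : ℤ, (M : ℤ) + b (Fin.last k) - a 0 ≤ p →
      ∃ z : X, zIter f p z = z ∧
        ∀ i, ∀ j : ℤ, a i ≤ j → j ≤ b i → dist (zIter f j z) (zIter f j (x i)) ≤ ε

/-- The set of `n`-periodic points. -/
def perSet (f : X → X) (n : ℕ) : Set X := {x | f^[n] x = x}

/-- The uniform (equidistributed) probability measure on the `n`-periodic points of `f`,
`μ_n = |Per_n(f)|⁻¹ ∑_{x ∈ Per_n(f)} δ_x`. -/
noncomputable def perMeasure [MeasurableSpace X] (f : X → X) (n : ℕ) : Measure X :=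
  ProbabilityTheory.uniformOn (perSet f n)

/-- The uniform probability measure on a set `s`,
`|s|⁻¹ ∑_{x ∈ s} δ_x`. -/
noncomputable def unifMeasure [MeasurableSpace X] (s : Set X) : Measure X :=
  ProbabilityTheory.uniformOn s

/-- Weak* convergence of a sequence of measures against continuous test functions. -/
def WeakLimit [TopologicalSpace X] [MeasurableSpace X] (μs : ℕ → Measure X) (ν : Measure X) :
    Prop :=
  ∀ φ : C(X, ℝ), Tendsto (fun n => ∫ x, φ x ∂(μs n)) atTop (𝓝 (∫ x, φ x ∂ν))

/-- `ν` is a weak* accumulation point of the sequence `μs`. -/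
def WeakClusterPt [TopologicalSpace X] [MeasurableSpace X] (μs : ℕ → Measure X)
    (ν : Measure X) : Prop :=
  ∃ u : ℕ → ℕ, StrictMono u ∧ WeakLimit (μs ∘ u) ν

/-- `E` is `(n,ε)`-separated for `g`. -/
def IsSep [PseudoMetricSpace X] (g : X → X) (n : ℕ) (ε : ℝ) (E : Set X) : Prop :=
  E.Pairwise fun x y => ∃ j < n, ε < dist (g^[j] x) (g^[j] y)

/-- Maximal cardinality of an `(n,ε)`-separated subset of `K` for `g`. -/
noncomputable def sepCard [PseudoMetricSpace X] (g : X → X) (K : Set X) (n : ℕ) (ε : ℝ) :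
    ℝ≥0∞ :=
  ⨆ (E : Finset X) (_ : ↑E ⊆ K ∧ IsSep g n ε ↑E), (E.card : ℝ≥0∞)

/-- Topological entropy of `g` relative to the set `K`:
`h_top(g,K) = lim_{ε→0} limsup_n (1/n) log E_K(n,ε)`; since the inner quantity is
monotone in `ε`, the limit as `ε → 0` is the supremum over `ε > 0`. -/
noncomputable def relEntropy [PseudoMetricSpace X] (g : X → X) (K : Set X) : EReal :=
  ⨆ (ε : ℝ) (_ : 0 < ε),
    Filter.limsup (fun n : ℕ => ENNReal.log (sepCard g K n ε) / (n : EReal)) atTop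

/-- Topological entropy of `g`. -/
noncomputable def topEntropy [PseudoMetricSpace X] (g : X → X) : EReal :=
  relEntropy g Set.univ

/-- A finite measurable partition of `X`. -/
def IsMPartition [MeasurableSpace X] (P : Finset (Set X)) : Prop :=
  (∀ A ∈ P, MeasurableSet A) ∧ ((P : Set (Set X)).PairwiseDisjoint id) ∧
    ⋃₀ (P : Set (Set X)) = Set.univ

/-- The entropy `H_μ(P ∨ g⁻¹P ∨ ⋯ ∨ g^{-(n-1)}P)` of the `n`-th dynamical refinement of the
partition `P`. -/
noncomputable def dynH [MeasurableSpace X] (μ : Measure X) (g : X → X) (P : Finset (Set X))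
    (n : ℕ) : ℝ :=
  ∑ A : Fin n → ↥P, Real.negMulLog (μ (⋂ i : Fin n, g^[i.1] ⁻¹' ((A i : Set X)))).toReal

/-- The measure-theoretic (Kolmogorov–Sinai) entropy `h_μ(g)`, using that for invariant `μ`
the limit `lim_n H_n/n` equals `inf_n H_n/n` by subadditivity. -/
noncomputable def mEntropy [MeasurableSpace X] (g : X → X) (μ : Measure X) : EReal :=
  ⨆ P : {P : Finset (Set X) // IsMPartition P},
    ⨅ n : ℕ, ((dynH μ g (P : Finset (Set X)) (n + 1) / (n + 1) : ℝ) : EReal)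

section Hyp

variable [MetricSpace X] [CompactSpace X] [MeasurableSpace X] [BorelSpace X]

/-- Hypothesis (H1): every class `[x] = h⁻¹(h x)` has zero relative topological entropy. -/
def HypH1 (g h : X → X) : Prop :=
  ∀ x : X, relEntropy g (h ⁻¹' {h x}) = 0

/-- Hypothesis (H2): every periodic class contains a `g`-periodic point whose `g`-period is
the `f`-period of `h x`. -/
def HypH2 (f g h : X → X) : Prop :=
  ∀ x : X, h x ∈ Function.periodicPts f →
    ∃ y : X, h y = h x ∧ Function.minimalPeriod g y = Function.minimalPeriod f (h x)

/-- Hypothesis (H3): the set of points whose class is trivial has full Bowen measure. -/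
def HypH3 (h : X → X) (μ : Measure X) : Prop :=
  μ {y : X | ∃ x : X, h ⁻¹' {y} = {x}} = 1

/-- `P` is an admissible choice of the sets `P̃er_n(g)`: `P n` consists of `g`-periodic points
of period `n` lying over `Per_n(f)`, and `h` maps `P n` bijectively onto `Per_n(f)`. -/
def IsPerSelection (f g h : X → X) (P : ℕ → Set X) : Prop :=
  ∀ n : ℕ, P n ⊆ perSet g n ∧ (∀ x ∈ P n, g x ∈ P n) ∧ Set.BijOn h (P n) (perSet f n)

end Hyp

end Samva

open Samva


namespace Samva
section Aux

theorem zIter_eq {X : Type*} [TopologicalSpace X] (f : X ≃ₜ X) (n : ℤ) (x : X) :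
    zIter f n x = ((f.toEquiv : Equiv.Perm X) ^ n) x := by
  cases n with
  | ofNat n =>
    simp only [zIter, Int.ofNat_eq_natCast, zpow_natCast]
    rw [← Equiv.Perm.iterate_eq_pow]; rfl
  | negSucc n =>
    simp only [zIter, zpow_negSucc]
    rw [← inv_pow, ← Equiv.Perm.iterate_eq_pow]; rfl

theorem zIter_add {X : Type*} [TopologicalSpace X] (f : X ≃ₜ X) (m n : ℤ) (x : X) :
    zIter f (m + n) x = zIter f m (zIter f n x) := by
  simp only [zIter_eq, zpow_add, Equiv.Perm.mul_apply]

theorem zIter_nat {X : Type*} [TopologicalSpace X] (f : X ≃ₜ X) (n : ℕ) (x : X) :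
    zIter f (n : ℤ) x = f^[n] x := rfl

theorem zIter_zero {X : Type*} [TopologicalSpace X] (f : X ≃ₜ X) (x : X) :
    zIter f 0 x = x := rfl

theorem zIter_cont {X : Type*} [TopologicalSpace X] (f : X ≃ₜ X) (n : ℤ) :
    Continuous (zIter f n) := by
  cases n with
  | ofNat n => exact f.continuous.iterate n
  | negSucc n => exact f.symm.continuous.iterate (n + 1)

theorem mem_perSet_iff {X : Type*} [TopologicalSpace X] (f : X ≃ₜ X) (n : ℕ) (x : X) :
    x ∈ perSet f n ↔ zIter f (n : ℤ) x = x := Iff.rfl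

theorem zIter_per {X : Type*} [TopologicalSpace X] (f : X ≃ₜ X) (n : ℕ) (x : X)
    (hx : x ∈ perSet f n) (t q : ℤ) : zIter f (t + n * q) x = zIter f t x := by
  rw [zIter_add]
  congr 1
  rw [mem_perSet_iff, zIter_eq] at hx
  rw [zIter_eq, zpow_mul]
  exact Equiv.Perm.zpow_apply_eq_self_of_apply_eq_self hx q

variable {X : Type*} [MetricSpace X]

theorem per_sep (f : X ≃ₜ X) {α : ℝ} (hα : IsExpansiveWith f α) {n : ℕ} (hn : 1 ≤ n)
    {x y : X} (hx : x ∈ perSet f n) (hy : y ∈ perSet f n) (a : ℤ)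
    (H : ∀ j : ℤ, a ≤ j → j < a + n → dist (zIter f j x) (zIter f j y) ≤ α) : x = y := by
  apply hα.2
  intro t
  have h1 := Int.emod_add_mul_ediv (t - a) n
  have h2 := Int.emod_nonneg (t - a) (b := n) (by omega)
  have h3 := Int.emod_lt_of_pos (t - a) (b := n) (by omega)
  have h4 : t = (a + (t - a) % n) + n * ((t - a) / n) := by omega
  rw [h4, zIter_per f n x hx, zIter_per f n y hy]
  exact H _ (by omega) (by omega)

theorem exists_code [CompactSpace X] {α : ℝ} (hα : 0 < α) :
    ∃ (D : ℕ) (c : X → Fin D), ∀ x y, c x = c y → dist x y ≤ α := by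
  classical
  obtain ⟨t, -, ht⟩ := isCompact_univ.elim_finite_subcover_image (X := X) (b := univ)
    (c := fun x => Metric.ball x (α / 2)) (fun x _ => Metric.isOpen_ball)
    (fun x _ => by simp only [mem_univ, iUnion_true, mem_iUnion]; exact ⟨x, Metric.mem_ball_self (by linarith)⟩)
  obtain ⟨hfin, hcov⟩ := ht
  have : ∀ x : X, ∃ i : t, dist x i < α / 2 := by
    intro x
    have := hcov (mem_univ x)
    simp only [mem_iUnion] at this
    obtain ⟨i, hi, hx⟩ := this
    exact ⟨⟨i, hi⟩, hx⟩
  choose c hc using this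
  have := hfin.fintype
  refine ⟨Fintype.card t, fun x => Fintype.equivFin t (c x), fun x y hxy => ?_⟩
  have hxy := (Fintype.equivFin t).injective hxy
  have h1 := hc x
  have h2 := hc y
  rw [← hxy] at h2
  have := dist_triangle_right x y (c x)
  linarith

theorem per_finite [CompactSpace X] (f : X ≃ₜ X) (hf : IsExpansive f) {n : ℕ} (hn : 1 ≤ n) :
    (perSet f n).Finite := by
  obtain ⟨α, hα⟩ := hf
  obtain ⟨D, c, hc⟩ := exists_code (X := X) hα.1
  apply Set.Finite.of_injOn (f := fun x => fun i : Fin n => c (zIter f (i : ℕ) x)) (t := univ)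
    (fun _ _ => mem_univ _) ?_ (Set.toFinite _)
  intro x hx y hy hxy
  apply per_sep f hα hn hx hy 0
  intro j hj hj'
  have := congrFun hxy ⟨j.toNat, by omega⟩
  simp only at this
  rw [Int.toNat_of_nonneg hj] at this
  exact hc _ _ this

theorem unif_exp [CompactSpace X] (f : X ≃ₜ X) {α : ℝ} (hα : IsExpansiveWith f α) {δ : ℝ}
    (hδ : 0 < δ) : ∃ r : ℕ, ∀ x y : X,
      (∀ j : ℤ, -r ≤ j → j ≤ r → dist (zIter f j x) (zIter f j y) ≤ α) → dist x y < δ := by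
  by_contra hcon
  push Not at hcon
  let C : ℕ → Set (X × X) := fun r => {p | δ ≤ dist p.1 p.2} ∩
    ⋂ j ∈ Set.Icc (-r : ℤ) r, {p | dist (zIter f j p.1) (zIter f j p.2) ≤ α}
  have hcl : ∀ r, IsClosed (C r) := by
    intro r
    refine (isClosed_le continuous_const (by fun_prop)).inter ?_
    refine isClosed_biInter fun j _ => isClosed_le ?_ continuous_const
    have := zIter_cont f j
    fun_prop
  have hne := IsCompact.nonempty_iInter_of_sequence_nonempty_isCompact_isClosed C
    (by
      intro r p hp
      refine ⟨hp.1, ?_⟩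
      have := hp.2
      simp only [mem_iInter, mem_Icc, mem_ofPred_eq] at this ⊢
      intro j hj
      exact this j (by push_cast; omega))
    (by
      intro r
      obtain ⟨x, y, h1, h2⟩ := hcon r
      refine ⟨(x, y), h2, ?_⟩
      simp only [mem_iInter, mem_Icc, mem_ofPred_eq]
      intro j hj
      exact h1 j hj.1 hj.2) (hcl 0).isCompact hcl
  obtain ⟨⟨x, y⟩, hp⟩ := hne
  rw [mem_iInter] at hp
  have hxy : x = y := by
    apply hα.2
    intro j
    have := (hp j.natAbs).2
    simp only [mem_iInter, mem_Icc, mem_ofPred_eq] at this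
    exact this j (by omega)
  have := (hp 0).1
  simp only [mem_ofPred_eq, hxy, dist_self] at this
  linarith

/-- the one-segment specification -/
theorem shadow1 (f : X ≃ₜ X) {ε : ℝ} {M : ℕ}
    (hM : ∀ (k : ℕ) (x : Fin (k + 1) → X) (a b : Fin (k + 1) → ℤ),
    (∀ i, a i ≤ b i) →
    (∀ i : Fin k, (M : ℤ) ≤ a i.succ - b i.castSucc) →
    ∀ p : ℤ, (M : ℤ) + b (Fin.last k) - a 0 ≤ p →
      ∃ z : X, zIter f p z = z ∧
        ∀ i, ∀ j : ℤ, a i ≤ j → j ≤ b i → dist (zIter f j z) (zIter f j (x i)) ≤ ε)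
    (w : X) (k : ℕ) (hk : M + 1 ≤ k) :
    ∃ x ∈ perSet f k, ∀ j : ℤ, 0 ≤ j → j < k - M → dist (zIter f j x) (zIter f j w) ≤ ε := by
  obtain ⟨z, hz, H⟩ := hM 0 (fun _ => w) (fun _ => 0) (fun _ => k - M - 1) (fun _ => by omega)
    (fun i => i.elim0) k (by omega)
  exact ⟨z, hz, fun j h1 h2 => H 0 j h1 (by omega)⟩

theorem shadow2 (f : X ≃ₜ X) {ε : ℝ} {M : ℕ}
    (hM : ∀ (k : ℕ) (x : Fin (k + 1) → X) (a b : Fin (k + 1) → ℤ),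
    (∀ i, a i ≤ b i) →
    (∀ i : Fin k, (M : ℤ) ≤ a i.succ - b i.castSucc) →
    ∀ p : ℤ, (M : ℤ) + b (Fin.last k) - a 0 ≤ p →
      ∃ z : X, zIter f p z = z ∧
        ∀ i, ∀ j : ℤ, a i ≤ j → j ≤ b i → dist (zIter f j z) (zIter f j (x i)) ≤ ε)
    (x y : X) (k l r : ℕ) (hk : 1 ≤ k) (hl : 1 ≤ l) :
    ∃ z ∈ perSet f (k + l + 2 * M),
      (∀ j : ℤ, -r ≤ j → j < -r + k → dist (zIter f j z) (zIter f j x) ≤ ε) ∧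
      (∀ j : ℤ, -r ≤ j → j < -r + l →
        dist (zIter f j (f^[k + M] z)) (zIter f j y) ≤ ε) := by
  obtain ⟨z, hz, H⟩ := hM 1 ![x, zIter f (-(k + M : ℕ)) y] ![-r, k + M - r]
    ![k - 1 - r, k + M + l - 1 - r]
    (by intro i; fin_cases i <;> simp <;> omega)
    (by intro i; fin_cases i; simp) (k + l + 2 * M : ℕ)
    (by
      have : Fin.last 1 = 1 := rfl
      rw [this]
      simp only [Matrix.cons_val_one, Matrix.cons_val_zero, Matrix.cons_val_fin_one]
      push_cast; omega)
  refine ⟨z, hz, fun j h1 h2 => ?_, fun j h1 h2 => ?_⟩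
  · exact H 0 j (by simpa using h1) (by simp; omega)
  · have := H 1 (j + (k + M : ℕ)) (by simp; omega) (by simp; omega)
    simp only [Matrix.cons_val_one, Matrix.cons_val_fin_one] at this
    rw [zIter_add, ← zIter_add f _ (-_), add_neg_cancel_right] at this
    exact this

theorem card_upper [CompactSpace X] (f : X ≃ₜ X) {α ε : ℝ} {M : ℕ} (hα : IsExpansiveWith f α)
    (hε : 2 * ε ≤ α)
    (hM : ∀ (k : ℕ) (x : Fin (k + 1) → X) (a b : Fin (k + 1) → ℤ),
    (∀ i, a i ≤ b i) →
    (∀ i : Fin k, (M : ℤ) ≤ a i.succ - b i.castSucc) →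
    ∀ p : ℤ, (M : ℤ) + b (Fin.last k) - a 0 ≤ p →
      ∃ z : X, zIter f p z = z ∧
        ∀ i, ∀ j : ℤ, a i ≤ j → j ≤ b i → dist (zIter f j z) (zIter f j (x i)) ≤ ε) :
    ∃ C : ℕ, ∀ k l : ℕ, M + 1 ≤ k → M + 1 ≤ l →
      (perSet f (k + l + 2 * M)).ncard ≤ C * ((perSet f k).ncard * (perSet f l).ncard) := by
  obtain ⟨D, c, hc⟩ := exists_code (X := X) hα.1
  refine ⟨Nat.card ((Fin M → Fin D) × (Fin (3 * M) → Fin D)), fun k l hk hl => ?_⟩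
  have hfk := per_finite f ⟨α, hα⟩ (n := k) (by omega)
  have hfl := per_finite f ⟨α, hα⟩ (n := l) (by omega)
  choose S hS hS' using fun w => shadow1 f hM w k hk
  choose T hT hT' using fun w => shadow1 f hM w l hl
  let Φ : X → ((Fin M → Fin D) × (Fin (3 * M) → Fin D)) × (X × X) := fun z =>
    ((fun i => c (zIter f (k - M + (i : ℕ)) z), fun i => c (zIter f (k + l - M + (i : ℕ)) z)),
      (S z, T (zIter f k z)))
  have key : (perSet f (k + l + 2 * M)).ncard ≤
      ((univ : Set ((Fin M → Fin D) × (Fin (3 * M) → Fin D))) ×ˢ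
        ((perSet f k) ×ˢ (perSet f l))).ncard := by
    refine Set.ncard_le_ncard_of_injOn Φ ?_ ?_ ((Set.toFinite _).prod (hfk.prod hfl))
    · intro z _
      exact ⟨mem_univ _, hS _, hT _⟩
    · intro z hz w hw hzw
      simp only [Φ, Prod.mk.injEq] at hzw
      obtain ⟨⟨e1, e2⟩, e3, e4⟩ := hzw
      apply per_sep f hα (by omega) hz hw 0
      intro j h1 h2
      push_cast at h2
      by_cases c1 : j < k - M
      · have a1 := hS' z j h1 c1
        have a2 := hS' w j h1 c1
        rw [← e3] at a2
        have := dist_triangle_left (zIter f j z) (zIter f j w) (zIter f j (S z))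
        linarith
      by_cases c2 : j < k
      · have := congrFun e1 ⟨(j - (k - M)).toNat, by omega⟩
        simp only at this
        rw [Int.toNat_of_nonneg (by omega), add_sub_cancel] at this
        exact hc _ _ this
      by_cases c3 : j < k + l - M
      · have a1 := hT' (zIter f k z) (j - k) (by omega) (by omega)
        have a2 := hT' (zIter f k w) (j - k) (by omega) (by omega)
        rw [← e4] at a2
        rw [← zIter_add, sub_add_cancel] at a1 a2
        have := dist_triangle_left (zIter f j z) (zIter f j w)
          (zIter f (j - k) (T (zIter f k z)))
        linarith
      · have := congrFun e2 ⟨(j - (k + l - M)).toNat, by omega⟩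
        simp only at this
        rw [Int.toNat_of_nonneg (by omega), add_sub_cancel] at this
        exact hc _ _ this
  rwa [Set.ncard_prod, Set.ncard_prod, Set.ncard_univ] at key


theorem integral_unif [MeasurableSpace X] [BorelSpace X] (s : Set X) (hs : s.Finite)
    (φ : X → ℝ) :
    ∫ x, φ x ∂(ProbabilityTheory.uniformOn s) = (s.ncard : ℝ)⁻¹ * ∑ x ∈ hs.toFinset, φ x := by
  rw [ProbabilityTheory.uniformOn, ProbabilityTheory.cond, integral_smul_measure]
  have h1 : (Measure.count s)⁻¹.toReal = (s.ncard : ℝ)⁻¹ := by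
    rw [ENNReal.toReal_inv, Measure.count_apply_finite s hs, ← Set.ncard_eq_toFinset_card s hs]
    simp
  rw [h1, smul_eq_mul]
  congr 1
  have h2 : (Measure.count.restrict s : Measure X) = ∑ x ∈ hs.toFinset, Measure.dirac x := by
    classical
    ext t ht
    rw [Measure.restrict_apply ht, Measure.count_apply_finite _ (hs.subset inter_subset_right),
      Measure.finsetSum_apply]
    simp only [Measure.dirac_apply' _ ht, Set.indicator_apply, Pi.one_apply]
    rw [← Finset.sum_filter, Finset.sum_const, nsmul_eq_mul, mul_one]
    congr 2
    ext x
    simp [and_comm]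
  rw [h2, integral_finsetSum_measure]
  · simp
  · intro i _
    exact integrable_dirac (by simp)

theorem mixing [CompactSpace X] [MeasurableSpace X] [BorelSpace X] [Nonempty X] (f : X ≃ₜ X)
    (hexp : IsExpansive f) (hspec : HasSpecification f) :
    ∃ (C : ℝ) (M : ℕ), 0 ≤ C ∧ ∀ φ ψ : C(X, ℝ), (∀ x, 0 ≤ φ x ∧ φ x ≤ 1) →
      (∀ x, 0 ≤ ψ x ∧ ψ x ≤ 1) → ∀ δ : ℝ, 0 < δ → ∃ k0 : ℕ, ∀ k l : ℕ, k0 ≤ k → k0 ≤ l →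
      (∫ x, φ x ∂(perMeasure f k)) * (∫ x, ψ x ∂(perMeasure f l)) ≤
        C * (∫ x, φ x * ψ (f^[k + M] x) ∂(perMeasure f (k + l + 2 * M))) + 2 * δ := by
  classical
  obtain ⟨α, hα⟩ := id hexp
  obtain ⟨M, hM⟩ := hspec (α / 2) (by linarith [hα.1])
  obtain ⟨C, hC⟩ := card_upper f hα (by linarith) hM
  refine ⟨C, M, by positivity, fun φ ψ hφ hψ δ hδ => ?_⟩
  obtain ⟨d1, hd1, H1⟩ := Metric.uniformContinuous_iff.1
    (CompactSpace.uniformContinuous_of_continuous φ.continuous) δ hδ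
  obtain ⟨d2, hd2, H2⟩ := Metric.uniformContinuous_iff.1
    (CompactSpace.uniformContinuous_of_continuous ψ.continuous) δ hδ
  obtain ⟨r, hr⟩ := unif_exp f hα (lt_min hd1 hd2)
  refine ⟨2 * r + 1 + M, fun k l hk hl => ?_⟩
  have hfk := per_finite f hexp (n := k) (by omega)
  have hfl := per_finite f hexp (n := l) (by omega)
  have hfN := per_finite f hexp (n := k + l + 2 * M) (by omega)
  obtain ⟨w⟩ := ‹Nonempty X›
  have pk : 0 < (perSet f k).ncard := by
    obtain ⟨x, hx, -⟩ := shadow1 f hM w k (by omega)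
    exact (Set.ncard_pos hfk).2 ⟨x, hx⟩
  have pl : 0 < (perSet f l).ncard := by
    obtain ⟨x, hx, -⟩ := shadow1 f hM w l (by omega)
    exact (Set.ncard_pos hfl).2 ⟨x, hx⟩
  have pN : 0 < (perSet f (k + l + 2 * M)).ncard := by
    obtain ⟨x, hx, -⟩ := shadow1 f hM w (k + l + 2 * M) (by omega)
    exact (Set.ncard_pos hfN).2 ⟨x, hx⟩
  have hCkl := hC k l (by omega) (by omega)
  unfold perMeasure
  rw [integral_unif _ hfk, integral_unif _ hfl, integral_unif _ hfN]
  choose Z hZ1 hZ2 hZ3 using fun x y => shadow2 f hM x y k l r (by omega) (by omega)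
  set n := k + M with hn
  have hinj : Set.InjOn (fun p : X × X => Z p.1 p.2)
      ↑(hfk.toFinset ×ˢ hfl.toFinset : Finset (X × X)) := by
    rintro ⟨x, y⟩ hp ⟨x', y'⟩ hp' he
    simp only [Finset.coe_product, Set.Finite.coe_toFinset, mem_prod] at hp hp'
    simp only at he
    have e1 : x = x' := by
      apply per_sep f hα (by omega) hp.1 hp'.1 (-r)
      intro j h1 h2
      have a1 := hZ2 x y j h1 h2
      have a2 := hZ2 x' y' j h1 h2
      rw [← he] at a2
      have := dist_triangle_left (zIter f j x) (zIter f j x') (zIter f j (Z x y))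
      linarith
    have e2 : y = y' := by
      apply per_sep f hα (by omega) hp.2 hp'.2 (-r)
      intro j h1 h2
      have a1 := hZ3 x y j h1 h2
      have a2 := hZ3 x' y' j h1 h2
      rw [← he] at a2
      have := dist_triangle_left (zIter f j y) (zIter f j y') (zIter f j (f^[n] (Z x y)))
      linarith
    rw [e1, e2]
  have hpt : ∀ x y, φ x * ψ y ≤ φ (Z x y) * ψ (f^[n] (Z x y)) + 2 * δ := by
    intro x y
    have b1 : dist (Z x y) x < min d1 d2 := hr _ _ (fun j h1 h2 =>
      (hZ2 x y j h1 (by omega)).trans (by linarith [hα.1]))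
    have b2 : dist (f^[n] (Z x y)) y < min d1 d2 := hr _ _ (fun j h1 h2 =>
      (hZ3 x y j h1 (by omega)).trans (by linarith [hα.1]))
    have c1 := H1 (b1.trans_le (min_le_left _ _))
    have c2 := H2 (b2.trans_le (min_le_right _ _))
    rw [Real.dist_eq, abs_lt] at c1 c2
    have := hφ x
    have := hφ (Z x y)
    have := hψ y
    have := hψ (f^[n] (Z x y))
    nlinarith
  set G : X → ℝ := fun z => φ z * ψ (f^[n] z) with hG
  have hGnn : ∀ z, 0 ≤ G z := fun z => mul_nonneg (hφ _).1 (hψ _).1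
  have hsum : (∑ x ∈ hfk.toFinset, φ x) * (∑ y ∈ hfl.toFinset, ψ y) ≤
      ∑ z ∈ hfN.toFinset, G z + ((perSet f k).ncard * (perSet f l).ncard : ℝ) * (2 * δ) := by
    rw [Finset.sum_mul_sum, ← Finset.sum_product']
    calc ∑ p ∈ hfk.toFinset ×ˢ hfl.toFinset, φ p.1 * ψ p.2
        ≤ ∑ p ∈ hfk.toFinset ×ˢ hfl.toFinset, (G (Z p.1 p.2) + 2 * δ) :=
          Finset.sum_le_sum fun p _ => hpt p.1 p.2
      _ = ∑ p ∈ hfk.toFinset ×ˢ hfl.toFinset, G (Z p.1 p.2) +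
          ((perSet f k).ncard * (perSet f l).ncard : ℝ) * (2 * δ) := by
          rw [Finset.sum_add_distrib, Finset.sum_const, Finset.card_product,
            ← Set.ncard_eq_toFinset_card _ hfk, ← Set.ncard_eq_toFinset_card _ hfl]
          simp
      _ ≤ _ := by
          gcongr
          rw [← Finset.sum_image (f := G) hinj]
          apply Finset.sum_le_sum_of_subset_of_nonneg
          · intro z hz
            simp only [Finset.mem_image] at hz
            obtain ⟨p, -, rfl⟩ := hz
            simpa using hZ1 p.1 p.2
          · intro z _ _
            exact hGnn z
  have hSG : 0 ≤ ∑ z ∈ hfN.toFinset, G z := Finset.sum_nonneg fun z _ => hGnn z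
  generalize (∑ x ∈ hfk.toFinset, φ x) = A at *
  generalize (∑ y ∈ hfl.toFinset, ψ y) = B at *
  generalize (∑ z ∈ hfN.toFinset, G z) = S at *
  have hCkl' : ((perSet f (k + l + 2 * M)).ncard : ℝ) ≤
      C * ((perSet f k).ncard * (perSet f l).ncard) := by exact_mod_cast hCkl
  have pk' : (0 : ℝ) < (perSet f k).ncard := by exact_mod_cast pk
  have pl' : (0 : ℝ) < (perSet f l).ncard := by exact_mod_cast pl
  have pN' : (0 : ℝ) < (perSet f (k + l + 2 * M)).ncard := by exact_mod_cast pN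
  generalize ((perSet f (k + l + 2 * M)).ncard : ℝ) = pn at *
  generalize ((perSet f k).ncard : ℝ) = a at *
  generalize ((perSet f l).ncard : ℝ) = b at *
  have hab : 0 < a * b := by positivity
  have key : A * B ≤ (a * b) * (C * (pn⁻¹ * S) + 2 * δ) := by
    have : S ≤ (a * b) * (C * (pn⁻¹ * S)) := by
      have e : (a * b) * (C * (pn⁻¹ * S)) = (C * (a * b)) * pn⁻¹ * S := by ring
      rw [e]
      have : 1 ≤ (C * (a * b)) * pn⁻¹ := by
        rw [← div_eq_mul_inv, le_div_iff₀ pN']; linarith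
      nlinarith
    nlinarith
  have e : a⁻¹ * A * (b⁻¹ * B) = (A * B) / (a * b) := by field_simp
  rw [e, div_le_iff₀ hab]
  linarith

theorem approx_ind [CompactSpace X] [MeasurableSpace X] [BorelSpace X] (μ : Measure X)
    [IsProbabilityMeasure μ] (E : Set X) (hE : MeasurableSet E) {η : ℝ} (hη : 0 < η) :
    ∃ φ : C(X, ℝ), (∀ x, 0 ≤ φ x ∧ φ x ≤ 1) ∧
      ∫ x, |E.indicator (fun _ => (1 : ℝ)) x - φ x| ∂μ ≤ η := by
  have hint : Integrable (E.indicator (fun _ => (1 : ℝ))) μ :=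
    (integrable_const (1 : ℝ)).indicator hE
  obtain ⟨g, hg, hgi⟩ := hint.exists_boundedContinuous_integral_sub_le hη
  refine ⟨⟨fun x => max 0 (min 1 (g x)), by fun_prop⟩, fun x => ⟨le_max_left _ _, ?_⟩, ?_⟩
  · exact max_le zero_le_one (min_le_left _ _)
  · refine le_trans (integral_mono_of_nonneg (ae_of_all _ fun x => abs_nonneg _)
      (hint.sub hgi).norm (ae_of_all _ fun x => ?_)) hg
    simp only [ContinuousMap.coe_mk, Pi.sub_apply, Real.norm_eq_abs]
    by_cases hx : x ∈ E
    · simp only [hx, Set.indicator_of_mem]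
      rcases le_total 1 (g x) with h1 | h1
      · rw [min_eq_left h1]; norm_num
      · rw [min_eq_right h1]
        rcases le_total 0 (g x) with h2 | h2
        · rw [max_eq_right h2]
        · rw [max_eq_left h2, abs_of_nonneg (by norm_num), abs_of_nonneg (by linarith)]; linarith
    · simp only [hx, not_false_eq_true, Set.indicator_of_notMem]
      rcases le_total 0 (g x) with h2 | h2
      · have : max 0 (min 1 (g x)) = min 1 (g x) := max_eq_right (le_min zero_le_one h2)
        rw [this, zero_sub, zero_sub, abs_neg, abs_neg, abs_of_nonneg h2,
          abs_of_nonneg (le_min zero_le_one h2)]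
        exact min_le_right _ _
      · have : max 0 (min 1 (g x)) = 0 := max_eq_left ((min_le_right _ _).trans h2)
        rw [this]; simp


theorem bowen_ergodic [CompactSpace X] [MeasurableSpace X] [BorelSpace X] (f : X ≃ₜ X)
    (hexp : IsExpansive f) (hspec : HasSpecification f) (μ : Measure X)
    [IsProbabilityMeasure μ] (hinv : MeasurePreserving f μ μ)
    (hμ : WeakLimit (perMeasure f) μ) : Ergodic f μ := by
  refine ⟨hinv, ⟨fun E hE hfE => ?_⟩⟩
  have : Nonempty X := nonempty_of_isProbabilityMeasure μ
  obtain ⟨C, M, hC, hmix⟩ := mixing f hexp hspec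
  rw [eventuallyConst_set']
  by_contra hcon
  push Not at hcon
  obtain ⟨hE0, hE1⟩ := hcon
  have hp : 0 < μ.real E := by
    refine ENNReal.toReal_pos (fun h => hE0 (ae_eq_empty.2 h)) (measure_ne_top _ _)
  have hq : 0 < μ.real Eᶜ := by
    refine ENNReal.toReal_pos (fun h => hE1 (ae_eq_univ.2 h)) (measure_ne_top _ _)
  have hiter : ∀ n x, f^[n] x ∈ E ↔ x ∈ E := by
    intro n
    induction n with
    | zero => intro x; rfl
    | succ n ih =>
      intro x
      rw [Function.iterate_succ_apply', ← ih x]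
      change f^[n] x ∈ f ⁻¹' E ↔ _
      rw [hfE]
  have hcint : ∀ F : C(X, ℝ), Integrable F μ := fun F =>
    F.continuous.integrable_of_hasCompactSupport (HasCompactSupport.of_compactSpace F)
  have hfc : ∀ n, Continuous (f^[n]) := fun n => f.continuous.iterate n
  have main : ∀ η : ℝ, 0 < η → η ≤ 1 → μ.real E * μ.real Eᶜ ≤ (2 * C + 5) * η := by
    intro η hη hη1
    obtain ⟨φ, hφ, hφi⟩ := approx_ind μ E hE hη
    obtain ⟨ψ, hψ, hψi⟩ := approx_ind μ Eᶜ hE.compl hη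
    have hiE : ∀ A : Set X, MeasurableSet A → Integrable (A.indicator (fun _ => (1 : ℝ))) μ :=
      fun A hA => (integrable_const (1 : ℝ)).indicator hA
    have hb : ∀ (A : Set X) (F : C(X, ℝ)), MeasurableSet A →
        ∫ x, |A.indicator (fun _ => (1 : ℝ)) x - F x| ∂μ ≤ η → μ.real A ≤ ∫ x, F x ∂μ + η := by
      intro A F hA hF
      have h1 : ∫ x, A.indicator (fun _ => (1 : ℝ)) x ∂μ = μ.real A := by
        rw [integral_indicator hA]; simp
      have h2 : ∫ x, (A.indicator (fun _ => (1 : ℝ)) x - F x) ∂μ ≤ η :=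
        (integral_mono ((hiE A hA).sub (hcint F)) ((hiE A hA).sub (hcint F)).abs
          (fun x => le_abs_self _)).trans hF
      rw [integral_sub (hiE A hA) (hcint F), h1] at h2
      linarith
    have h01 : ∀ F : C(X, ℝ), (∀ x, 0 ≤ F x ∧ F x ≤ 1) →
        0 ≤ ∫ x, F x ∂μ ∧ ∫ x, F x ∂μ ≤ 1 := by
      intro F hF
      refine ⟨integral_nonneg fun x => (hF x).1, ?_⟩
      have := integral_mono (hcint F) (integrable_const (1 : ℝ)) (fun x => (hF x).2)
      simpa using this
    have hsmall : ∀ n, ∫ x, φ x * ψ (f^[n] x) ∂μ ≤ 2 * η := by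
      intro n
      let d1 : X → ℝ := fun x => |E.indicator (fun _ => (1 : ℝ)) x - φ x|
      let d2 : X → ℝ := fun x => |Eᶜ.indicator (fun _ => (1 : ℝ)) x - ψ x|
      have hd1 : Integrable d1 μ := ((hiE E hE).sub (hcint φ)).abs
      have hd2 : Integrable d2 μ := ((hiE _ hE.compl).sub (hcint ψ)).abs
      have hmp := hinv.iterate n
      have hd2' : Integrable (fun x => d2 (f^[n] x)) μ := hmp.integrable_comp_of_integrable hd2
      have hd2i : ∫ x, d2 (f^[n] x) ∂μ = ∫ x, d2 x ∂μ := by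
        have := integral_map (μ := μ) hmp.measurable.aemeasurable (f := d2)
          (by rw [hmp.map_eq]; exact hd2.aestronglyMeasurable)
        rw [hmp.map_eq] at this
        exact this.symm
      have hle : ∫ x, φ x * ψ (f^[n] x) ∂μ ≤ ∫ x, (d1 x + d2 (f^[n] x)) ∂μ := by
        refine integral_mono (hcint ⟨fun x => φ x * ψ (f^[n] x), ?_⟩) (hd1.add hd2') ?_
        · have := hfc n
          fun_prop
        · intro x
          have a1 := hφ x
          have a2 := hψ (f^[n] x)
          by_cases hx : x ∈ E
          · have hx' : f^[n] x ∉ Eᶜ := fun h => h ((hiter n x).2 hx)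
            have e2 : d2 (f^[n] x) = ψ (f^[n] x) := by
              simp only [d2, Set.indicator_of_notMem hx', zero_sub, abs_neg]
              exact abs_of_nonneg a2.1
            have e1 : 0 ≤ d1 x := abs_nonneg _
            simp only [e2]
            nlinarith
          · have e1 : d1 x = φ x := by
              simp only [d1, Set.indicator_of_notMem hx, zero_sub, abs_neg]
              exact abs_of_nonneg a1.1
            have e2 : 0 ≤ d2 (f^[n] x) := abs_nonneg _
            simp only [e1]
            nlinarith
      rw [integral_add hd1 hd2', hd2i] at hle
      change ∫ x, d1 x ∂μ ≤ η at hφi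
      change ∫ x, d2 x ∂μ ≤ η at hψi
      linarith
    obtain ⟨k0, hk0⟩ := hmix φ ψ hφ hψ η hη
    have step1 : ∀ k, k0 ≤ k →
        (∫ x, φ x ∂(perMeasure f k)) * (∫ x, ψ x ∂μ) ≤ C * (2 * η) + 2 * η := by
      intro k hk
      have t1 := (hμ ψ).const_mul (∫ x, φ x ∂(perMeasure f k))
      let Φ : C(X, ℝ) := ⟨fun x => φ x * ψ (f^[k + M] x), by
        have := hfc (k + M)
        fun_prop⟩
      have t2 : Tendsto (fun l : ℕ => C * (∫ x, Φ x ∂(perMeasure f (k + l + 2 * M))) + 2 * η)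
          atTop (𝓝 (C * (∫ x, Φ x ∂μ) + 2 * η)) := by
        refine (((hμ Φ).comp ?_).const_mul C).add_const _
        exact tendsto_atTop_mono (fun l => by omega : ∀ l : ℕ, l ≤ k + l + 2 * M) tendsto_id
      have t3 := le_of_tendsto_of_tendsto t1 t2
        (eventually_atTop.2 ⟨k0, fun l hl => hk0 k l hk hl⟩)
      have t4 : ∫ x, Φ x ∂μ ≤ 2 * η := hsmall (k + M)
      nlinarith
    have step2 : (∫ x, φ x ∂μ) * (∫ x, ψ x ∂μ) ≤ C * (2 * η) + 2 * η :=
      le_of_tendsto ((hμ φ).mul_const _) (eventually_atTop.2 ⟨k0, step1⟩)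
    have u1 := hb E φ hE hφi
    have u2 := hb _ ψ hE.compl hψi
    have v1 := h01 φ hφ
    have v2 := h01 ψ hψ
    have : μ.real E * μ.real Eᶜ ≤ (∫ x, φ x ∂μ + η) * (∫ x, ψ x ∂μ + η) :=
      mul_le_mul u1 u2 hq.le (by linarith)
    nlinarith
  have hpq : 0 < μ.real E * μ.real Eᶜ := mul_pos hp hq
  have hpq1 : μ.real E * μ.real Eᶜ ≤ 1 :=
    mul_le_one₀ measureReal_le_one hq.le measureReal_le_one
  have := main (μ.real E * μ.real Eᶜ / (2 * (2 * C + 5))) (by positivity)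
    (by rw [div_le_one (by positivity)]; linarith)
  have e : (2 * C + 5) * (μ.real E * μ.real Eᶜ / (2 * (2 * C + 5))) =
    μ.real E * μ.real Eᶜ / 2 := by field_simp
  linarith

theorem meas_trivial [CompactSpace X] [MeasurableSpace X] [BorelSpace X] (h : X → X)
    (hcont : Continuous h) (hsurj : Function.Surjective h) :
    MeasurableSet {y : X | ∃ x : X, h ⁻¹' {y} = {x}} := by
  have : {y : X | ∃ x : X, h ⁻¹' {y} = {x}} =
      (⋃ m : ℕ, (fun p : X × X => h p.1) ''
        {p | h p.1 = h p.2 ∧ 1 / ((m : ℝ) + 1) ≤ dist p.1 p.2})ᶜ := by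
    ext y
    simp only [mem_ofPred_eq, mem_compl_iff, mem_iUnion, mem_image, not_exists, not_and]
    constructor
    · rintro ⟨x, hx⟩ m ⟨a, b⟩ ⟨h1, h2⟩ h3
      simp only at h1 h2 h3
      have ha : a ∈ h ⁻¹' {y} := h3
      have hb : b ∈ h ⁻¹' {y} := h1.symm.trans h3
      rw [hx, mem_singleton_iff] at ha hb
      rw [ha, hb, dist_self] at h2
      have : 0 < 1 / ((m : ℝ) + 1) := by positivity
      linarith
    · intro H
      obtain ⟨x, rfl⟩ := hsurj y
      refine ⟨x, Set.eq_singleton_iff_unique_mem.2 ⟨rfl, fun z hz => ?_⟩⟩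
      by_contra hne
      obtain ⟨m, hm⟩ := exists_nat_one_div_lt (dist_pos.2 hne)
      exact H m (z, x) ⟨hz, hm.le⟩ hz
  rw [this]
  refine (MeasurableSet.iUnion fun m => ?_).compl
  apply IsClosed.measurableSet
  apply IsCompact.isClosed
  refine IsCompact.image ?_ (hcont.comp continuous_fst)
  apply IsClosed.isCompact
  have c1 : IsClosed {p : X × X | h p.1 = h p.2} :=
    isClosed_eq (hcont.comp continuous_fst) (hcont.comp continuous_snd)
  have c2 : IsClosed {p : X × X | 1 / ((m : ℝ) + 1) ≤ dist p.1 p.2} :=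
    isClosed_le continuous_const continuous_dist
  exact c1.inter c2

theorem ext_cont [CompactSpace X] [MeasurableSpace X] [BorelSpace X] (μ ν : Measure X)
    [IsFiniteMeasure μ] [IsFiniteMeasure ν] (H : ∀ φ : C(X, ℝ), ∫ x, φ x ∂μ = ∫ x, φ x ∂ν) :
    μ = ν :=
  ext_of_forall_integral_eq_of_IsFiniteMeasure fun φ => H φ.toContinuousMap

end Aux
end Samva

/-- Under (H3), any weak* accumulation point `ν` of `(ν_n)` is an ergodic `g`-invariant
probability measure. -/
theorem accumulation_point_ergodic
    {X : Type*} [MetricSpace X] [CompactSpace X] [MeasurableSpace X] [BorelSpace X]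
    (f g : X ≃ₜ X) (h : X → X) (hcont : Continuous h) (hsurj : Function.Surjective h)
    (hsemi : ∀ x : X, f (h x) = h (g x))
    (hexp : IsExpansive f) (hspec : HasSpecification f)
    (μ : Measure X) (hμprob : IsProbabilityMeasure μ)
    (hμ : WeakLimit (perMeasure (⇑f)) μ)
    (H2 : HypH2 (⇑f) (⇑g) h) (H3 : HypH3 h μ)
    (P : ℕ → Set X) (hP : IsPerSelection (⇑f) (⇑g) h P)
 :
    ∀ ν : Measure X, WeakClusterPt (fun n => unifMeasure (P n)) ν →
      IsProbabilityMeasure ν ∧ Measure.map (⇑g) ν = ν ∧ Ergodic (⇑g) ν := by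
  intro ν hν
  obtain ⟨u, hu, hlim⟩ := hν
  have hut := hu.tendsto_atTop
  have hPfin : ∀ n, 1 ≤ n → (P n).Finite := fun n hn =>
    (hP n).2.2.finite_iff_finite.2 (per_finite f hexp hn)
  have hev : ∀ᶠ n in atTop, 1 ≤ u n := hut.eventually_ge_atTop 1
  -- push-forward identity
  have hpush : ∀ n, 1 ≤ n → ∀ φ : C(X, ℝ),
      ∫ x, φ (h x) ∂(unifMeasure (P n)) = ∫ x, φ x ∂(perMeasure f n) := by
    intro n hn φ
    have hb := (hP n).2.2
    unfold unifMeasure perMeasure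
    rw [integral_unif _ (hPfin n hn) (fun x => φ (h x)),
      integral_unif _ (per_finite f hexp hn)]
    have hc : (P n).ncard = (perSet f n).ncard := by
      rw [← hb.image_eq, Set.ncard_image_of_injOn hb.injOn]
    rw [hc]
    congr 1
    refine Finset.sum_bij (fun x _ => h x) ?_ ?_ ?_ ?_
    · intro a ha
      simpa using hb.mapsTo (by simpa using ha)
    · intro a ha b hb' hab
      exact hb.injOn (by simpa using ha) (by simpa using hb') hab
    · intro b hb'
      obtain ⟨a, ha, rfl⟩ := hb.surjOn (show b ∈ perSet f n by simpa using hb')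
      exact ⟨a, by simpa using ha, rfl⟩
    · intro a _; rfl
  have hginv : ∀ n, 1 ≤ n → ∀ φ : C(X, ℝ),
      ∫ x, φ (g x) ∂(unifMeasure (P n)) = ∫ x, φ x ∂(unifMeasure (P n)) := by
    intro n hn φ
    unfold unifMeasure
    rw [integral_unif _ (hPfin n hn) (fun x => φ (g x)), integral_unif _ (hPfin n hn)]
    congr 1
    have hmaps : ∀ a ∈ (hPfin n hn).toFinset, g a ∈ (hPfin n hn).toFinset := by
      intro a ha
      have := (hP n).2.1 a (by simpa using ha)
      simpa using this
    have hsj := Finset.surj_on_of_inj_on_of_card_le (s := (hPfin n hn).toFinset)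
      (t := (hPfin n hn).toFinset) (fun a _ => g a) hmaps
      (fun a b _ _ hab => g.injective hab) le_rfl
    refine Finset.sum_bij (fun x _ => g x) hmaps (fun a _ b _ hab => g.injective hab) ?_
      (fun a _ => rfl)
    intro b hb
    obtain ⟨a, ha, he⟩ := hsj b hb
    exact ⟨a, ha, he.symm⟩
  -- integrals of pullbacks
  have hνμ : ∀ φ : C(X, ℝ), ∫ x, φ (h x) ∂ν = ∫ x, φ x ∂μ := by
    intro φ
    have t1 := hlim (φ.comp ⟨h, hcont⟩)
    have t2 := (hμ φ).comp hut
    refine tendsto_nhds_unique (t1.congr' ?_) t2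
    filter_upwards [hev] with n hn
    exact hpush (u n) hn φ
  have hνg : ∀ φ : C(X, ℝ), ∫ x, φ (g x) ∂ν = ∫ x, φ x ∂ν := by
    intro φ
    have t1 := hlim (φ.comp ⟨g, g.continuous⟩)
    have t2 := hlim φ
    refine tendsto_nhds_unique (t1.congr' ?_) t2
    filter_upwards [hev] with n hn
    exact hginv (u n) hn φ
  have hprob : IsProbabilityMeasure ν := by
    have h1 := hνμ 1
    simp only [ContinuousMap.one_apply, integral_const, smul_eq_mul, mul_one, probReal_univ,
      Measure.real] at h1
    refine ⟨?_⟩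
    have := (ENNReal.toReal_eq_one_iff _).1 (h1.trans (by simp))
    exact this
  have hmapg : Measure.map g ν = ν := by
    have : IsFiniteMeasure (Measure.map g ν) := inferInstance
    apply ext_cont
    intro φ
    rw [integral_map g.continuous.measurable.aemeasurable
      φ.continuous.aestronglyMeasurable]
    exact hνg φ
  have hmaph : Measure.map h ν = μ := by
    apply ext_cont
    intro φ
    rw [integral_map hcont.measurable.aemeasurable φ.continuous.aestronglyMeasurable]
    exact hνμ φ
  have hg : MeasurePreserving g ν ν := ⟨g.continuous.measurable, hmapg⟩
  have hh : MeasurePreserving h ν μ := ⟨hcont.measurable, hmaph⟩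
  have hf : MeasurePreserving f μ μ := by
    refine ⟨f.continuous.measurable, ?_⟩
    have hcomp : (f : X → X) ∘ h = h ∘ g := funext hsemi
    rw [← hmaph, Measure.map_map f.continuous.measurable hcont.measurable, hcomp,
      ← Measure.map_map hcont.measurable g.continuous.measurable, hmapg]
  have herg := bowen_ergodic f hexp hspec μ hf hμ
  refine ⟨hprob, hmapg, hg, ⟨fun E hE hgE => ?_⟩⟩
  set T : Set X := {y : X | ∃ x : X, h ⁻¹' {y} = {x}} with hT
  have hTm : MeasurableSet T := meas_trivial h hcont hsurj
  have hTfull : ∀ᵐ x ∂ν, h x ∈ T := by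
    have : ∀ᵐ y ∂μ, y ∈ T := (mem_ae_iff_prob_eq_one hTm).2 H3
    exact hh.quasiMeasurePreserving.ae this
  have huniq : ∀ x z, h x ∈ T → h z = h x → z = x := by
    rintro x z ⟨w, hw⟩ hz
    have h1 : x ∈ h ⁻¹' {h x} := rfl
    have h2 : z ∈ h ⁻¹' {h x} := hz
    rw [hw] at h1 h2
    exact (mem_singleton_iff.1 h2).trans (mem_singleton_iff.1 h1).symm
  set F : Set X := h '' (E ∩ h ⁻¹' T) with hF
  have hFm : MeasurableSet F := by
    apply MeasurableSet.image_of_continuousOn_injOn (hE.inter (hcont.measurable hTm))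
      hcont.continuousOn
    intro a ha b hb hab
    exact huniq b a hb.2 hab
  have hFE : h ⁻¹' F =ᵐ[ν] E := by
    filter_upwards [hTfull] with x hx
    apply propext
    constructor
    · rintro ⟨z, hz, hzx⟩
      have := huniq x z hx hzx
      rw [← this]; exact hz.1
    · intro hxE
      exact ⟨x, ⟨hxE, hx⟩, rfl⟩
  have hfF : f ⁻¹' F =ᵐ[μ] F := by
    have h1 : h ⁻¹' (f ⁻¹' F) =ᵐ[ν] h ⁻¹' F := by
      have e : h ⁻¹' (f ⁻¹' F) = g ⁻¹' (h ⁻¹' F) := by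
        ext x
        simp only [mem_preimage, hsemi]
      rw [e]
      have h2 : g ⁻¹' (h ⁻¹' F) =ᵐ[ν] g ⁻¹' E :=
        hg.quasiMeasurePreserving.preimage_ae_eq hFE
      rw [hgE] at h2
      exact h2.trans hFE.symm
    rw [← hmaph]
    have hm : MeasurableSet {y | (f ⁻¹' F) y = F y} := by
      have : {y | (f ⁻¹' F) y = F y} = (symmDiff (f ⁻¹' F) F)ᶜ := by
        ext y
        simp only [mem_ofPred_eq, mem_compl_iff, mem_symmDiff, eq_iff_iff]
        change (y ∈ f ⁻¹' F ↔ y ∈ F) ↔ _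
        tauto
      rw [this]
      exact ((f.continuous.measurable hFm).symmDiff hFm).compl
    exact (ae_map_iff hcont.measurable.aemeasurable hm).2 h1
  have hc := herg.quasiErgodic.ae_empty_or_univ₀ hFm.nullMeasurableSet hfF
  rw [eventuallyConst_set']
  rcases hc with hc | hc
  · left
    exact hFE.symm.trans (hh.quasiMeasurePreserving.preimage_ae_eq hc)
  · right
    exact hFE.symm.trans (hh.quasiMeasurePreserving.preimage_ae_eq hc)
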